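/- arXiv:2208.06122 — 8 statements merged into one kernel-verified Lean document; each statement's English description precedes it below -/
import Mathlib

section
/- Let Q be a finite set of points contained in the unit square R = [0,1]×[0,1], let W be a finite family of axis-parallel unit squares in general position, each containing exactly one of the two top corners c₁ = (0,1) and c₂ = (1,1) of R, and suppose some subfamily of W covers Q. Let S ⊆ W be a cover of Q with ply(S) = ply*(Q,W) such that every square of S is necessary (i.e., for every B ∈ S, the family S∖{B} does not cover Q). Then there exists T ⊆ S with |T| ≤ 1 such that no square of S∖T containing c₁ intersects any square of S∖T containing c₂. -/
open Set

noncomputable section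

/-- The axis-parallel unit square `[a,a+1] × [b,b+1]` in `ℝ²`. -/
def unitSq (a b : ℝ) : Set (ℝ × ℝ) :=
  Set.Icc a (a + 1) ×ˢ Set.Icc b (b + 1)

/-- A set is an axis-parallel unit square. -/
def IsUnitSquare (s : Set (ℝ × ℝ)) : Prop := ∃ a b : ℝ, s = unitSq a b

/-- A finite family `S` covers a point set `Q`. -/
def Covers (S : Finset (Set (ℝ × ℝ))) (Q : Set (ℝ × ℝ)) : Prop :=
  Q ⊆ ⋃ s ∈ S, s

/-- Number of members of `S` containing the point `p`. -/
def plyAt (S : Finset (Set (ℝ × ℝ))) (p : ℝ × ℝ) : ℕ :=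
  {s : Set (ℝ × ℝ) | s ∈ S ∧ p ∈ s}.ncard

/-- The ply of a finite family of subsets of `ℝ²`: the maximum, over points `p`,
of the number of members containing `p`. -/
def ply (S : Finset (Set (ℝ × ℝ))) : ℕ :=
  sSup {n : ℕ | ∃ p : ℝ × ℝ, n = plyAt S p}

/-- The minimum ply cover number of `Q` with `W`. -/
def plyStar (Q : Set (ℝ × ℝ)) (W : Finset (Set (ℝ × ℝ))) : ℕ :=
  sInf {n : ℕ | ∃ S : Finset (Set (ℝ × ℝ)), S ⊆ W ∧ Covers S Q ∧ ply S = n}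

/-- General position: no two distinct squares of the family have edges lying on a
common vertical or horizontal line. -/
def GeneralPosition (W : Finset (Set (ℝ × ℝ))) : Prop :=
  ∀ s ∈ W, ∀ t ∈ W, s ≠ t →
    ∀ a b a' b' : ℝ, s = unitSq a b → t = unitSq a' b' →
      a ≠ a' ∧ a ≠ a' + 1 ∧ a + 1 ≠ a' ∧ b ≠ b' ∧ b ≠ b' + 1 ∧ b + 1 ≠ b'

noncomputable instance : DecidableEq (Set (ℝ × ℝ)) := Classical.decEq _

/-- A necessary square of a cover contains a point of `Q` lying in no other square. -/
theorem exists_private_point {Q : Set (ℝ × ℝ)} {S : Finset (Set (ℝ × ℝ))}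
    (hcov : Covers S Q) {s : Set (ℝ × ℝ)} (hs : ¬ Covers (S.erase s) Q) :
    ∃ q ∈ Q, q ∈ s ∧ ∀ t ∈ S, t ≠ s → q ∉ t := by
  obtain ⟨q, hq, hqs⟩ := Set.not_subset.1 hs
  have hother : ∀ t ∈ S, t ≠ s → q ∉ t := fun t ht hts hqt =>
    hqs (Set.mem_biUnion (Finset.mem_coe.2 (Finset.mem_erase.2 ⟨hts, ht⟩)) hqt)
  obtain ⟨t, ht, hqt⟩ := Set.mem_iUnion₂.1 (hcov hq)
  by_cases hts : t = s
  · exact ⟨q, hq, hts ▸ hqt, hother⟩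
  · exact absurd hqt (hother t ht hts)

theorem mem_unitSq {a b : ℝ} {p : ℝ × ℝ} :
    p ∈ unitSq a b ↔ a ≤ p.1 ∧ p.1 ≤ a + 1 ∧ b ≤ p.2 ∧ p.2 ≤ b + 1 := by
  simp only [unitSq, Set.mem_prod, Set.mem_Icc, and_assoc]

/-- For a minimum ply cover `S` of `Q` by squares each containing exactly one
of the two top corners of `R = [0,1]²`, with every square of `S` necessary, one can remove
at most one square of `S` so that no remaining square containing the top-left corner
intersects a remaining square containing the top-right corner. -/
theorem min_ply_cover_top_corners_almost_separated
    (Q : Finset (ℝ × ℝ)) (W : Finset (Set (ℝ × ℝ)))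
    (hQ : (↑Q : Set (ℝ × ℝ)) ⊆ unitSq 0 0)
    (hW : ∀ s ∈ W, IsUnitSquare s)
    (hGP : GeneralPosition W)
    (hcorner : ∀ s ∈ W, Xor' (((0 : ℝ), (1 : ℝ)) ∈ s) (((1 : ℝ), (1 : ℝ)) ∈ s))
    (hcov : ∃ S : Finset (Set (ℝ × ℝ)), S ⊆ W ∧ Covers S ↑Q)
    (S : Finset (Set (ℝ × ℝ))) (hSW : S ⊆ W) (hScov : Covers S ↑Q)
    (hply : ply S = plyStar ↑Q W)
    (hnec : ∀ B ∈ S, ¬ Covers (S.erase B) ↑Q) :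
    ∃ T ⊆ S, T.card ≤ 1 ∧
      ∀ s ∈ S \ T, ∀ t ∈ S \ T,
        ((0 : ℝ), (1 : ℝ)) ∈ s → ((1 : ℝ), (1 : ℝ)) ∈ t → s ∩ t = ∅ := by
  classical
  have hsq : ∀ s, ∃ a b : ℝ, s ∈ S → s = unitSq a b := fun s => by
    by_cases hs : s ∈ S
    · obtain ⟨a, b, h⟩ := hW s (hSW hs)
      exact ⟨a, b, fun _ => h⟩
    · exact ⟨0, 0, fun h => absurd h hs⟩
  choose x y hxy using hsq
  have hmem : ∀ s ∈ S, ∀ p : ℝ × ℝ,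
      p ∈ s ↔ x s ≤ p.1 ∧ p.1 ≤ x s + 1 ∧ y s ≤ p.2 ∧ p.2 ≤ y s + 1 := fun s hs p => by
    rw [← mem_unitSq, ← hxy s hs]
  have hpriv : ∀ s ∈ S, ∃ q : ℝ × ℝ, (0 ≤ q.1 ∧ q.1 ≤ 1 ∧ 0 ≤ q.2 ∧ q.2 ≤ 1) ∧
      q ∈ s ∧ ∀ t ∈ S, t ≠ s → q ∉ t := fun s hs => by
    obtain ⟨q, hq, hqs⟩ := exists_private_point hScov (hnec s hs)
    have hqR := mem_unitSq.1 (hQ hq)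
    norm_num at hqR
    exact ⟨q, hqR, hqs⟩
  set L := S.filter fun s => ((0 : ℝ), (1 : ℝ)) ∈ s
  set R := S.filter fun s => ((1 : ℝ), (1 : ℝ)) ∈ s
  have hLbd : ∀ s ∈ L, s ∈ S ∧ x s < 0 ∧ 0 ≤ x s + 1 ∧ 0 ≤ y s ∧ y s ≤ 1 := fun s hs => by
    obtain ⟨hsS, h0⟩ := Finset.mem_filter.1 hs
    have h1 : ((1 : ℝ), (1 : ℝ)) ∉ s := fun h1 => by
      rcases hcorner s (hSW hsS) with h | h
      · exact h.2 h1
      · exact h.2 h0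
    rw [hmem s hsS] at h0 h1
    dsimp only at h0 h1
    refine ⟨hsS, ?_, by linarith, by linarith, by linarith⟩
    by_contra! hx
    exact h1 ⟨by linarith, by linarith, by linarith, by linarith⟩
  have hRbd : ∀ s ∈ R, s ∈ S ∧ 0 < x s ∧ x s ≤ 1 ∧ 0 ≤ y s ∧ y s ≤ 1 := fun s hs => by
    obtain ⟨hsS, h1⟩ := Finset.mem_filter.1 hs
    have h0 : ((0 : ℝ), (1 : ℝ)) ∉ s := fun h0 => by
      rcases hcorner s (hSW hsS) with h | h
      · exact h.2 h1
      · exact h.2 h0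
    rw [hmem s hsS] at h0 h1
    dsimp only at h0 h1
    refine ⟨hsS, ?_, by linarith, by linarith, by linarith⟩
    by_contra! hx
    exact h0 ⟨by linarith, by linarith, by linarith, by linarith⟩
  by_contra! hcon
  have hpair : ∀ T ⊆ S, T.card ≤ 1 →
      ∃ s ∈ L, ∃ t ∈ R, s ∉ T ∧ t ∉ T ∧ x t ≤ x s + 1 := fun T hT hcard => by
    obtain ⟨s, hs, t, ht, hs0, ht1, hne⟩ := hcon T hT hcard
    obtain ⟨hsS, hsT⟩ := Finset.mem_sdiff.1 hs
    obtain ⟨htS, htT⟩ := Finset.mem_sdiff.1 ht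
    obtain ⟨p, hps, hpt⟩ := hne
    refine ⟨s, Finset.mem_filter.2 ⟨hsS, hs0⟩, t, Finset.mem_filter.2 ⟨htS, ht1⟩, hsT, htT, ?_⟩
    rw [hmem s hsS] at hps
    rw [hmem t htS] at hpt
    linarith
  obtain ⟨l, hl, r, hr, -⟩ := hpair ∅ (Finset.empty_subset _) (by simp)
  obtain ⟨l₁, hl₁, hlmax⟩ := Finset.exists_max_image L x ⟨l, hl⟩
  obtain ⟨r₁, hr₁, hrmin⟩ := Finset.exists_min_image R x ⟨r, hr⟩
  obtain ⟨hl₁S, hl₁b⟩ := hLbd l₁ hl₁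
  obtain ⟨hr₁S, hr₁b⟩ := hRbd r₁ hr₁
  obtain ⟨l₂, hl₂, t, ht, hne_l, -, hlt⟩ :=
    hpair {l₁} (Finset.singleton_subset_iff.2 hl₁S) (by simp)
  obtain ⟨s, hs, r₂, hr₂, -, hne_r, hsr⟩ :=
    hpair {r₁} (Finset.singleton_subset_iff.2 hr₁S) (by simp)
  rw [Finset.mem_singleton] at hne_l hne_r
  obtain ⟨hl₂S, hl₂b⟩ := hLbd l₂ hl₂
  obtain ⟨hr₂S, hr₂b⟩ := hRbd r₂ hr₂
  have hl₂₁ := hlmax l₂ hl₂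
  have hr₁₂ := hrmin r₂ hr₂
  have hl₂r₁ : x r₁ ≤ x l₂ + 1 := (hrmin t ht).trans hlt
  have hl₁r₂ : x r₂ ≤ x l₁ + 1 := by linarith [hlmax s hs]
  have hne : l₁ ≠ r₁ := fun h => by
    rw [h] at hl₁b
    linarith
  have hyl : y l₂ < y l₁ := by
    obtain ⟨q, hq, hql, hqo⟩ := hpriv l₂ hl₂S
    have h := hqo l₁ hl₁S (Ne.symm hne_l)
    rw [hmem l₂ hl₂S] at hql
    rw [hmem l₁ hl₁S] at h
    by_contra! hle
    exact h ⟨by linarith, by linarith, by linarith, by linarith⟩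
  have hyr : y r₂ < y r₁ := by
    obtain ⟨q, hq, hqr, hqo⟩ := hpriv r₂ hr₂S
    have h := hqo r₁ hr₁S (Ne.symm hne_r)
    rw [hmem r₂ hr₂S] at hqr
    rw [hmem r₁ hr₁S] at h
    by_contra! hle
    exact h ⟨by linarith, by linarith, by linarith, by linarith⟩
  have hlr : y l₁ < y r₁ := by
    obtain ⟨q, hq, hql, hqo⟩ := hpriv l₁ hl₁S
    have h₂ := hqo l₂ hl₂S hne_l
    have h := hqo r₁ hr₁S hne.symm
    rw [hmem l₁ hl₁S] at hql
    rw [hmem l₂ hl₂S] at h₂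
    rw [hmem r₁ hr₁S] at h
    by_contra! hle
    have hx : x l₂ + 1 < q.1 := by
      by_contra! hx
      exact h₂ ⟨by linarith, by linarith, by linarith, by linarith⟩
    exact h ⟨by linarith, by linarith, by linarith, by linarith⟩
  have hrl : y r₁ < y l₁ := by
    obtain ⟨q, hq, hqr, hqo⟩ := hpriv r₁ hr₁S
    have h₂ := hqo r₂ hr₂S hne_r
    have h := hqo l₁ hl₁S hne
    rw [hmem r₁ hr₁S] at hqr
    rw [hmem r₂ hr₂S] at h₂
    rw [hmem l₁ hl₁S] at h
    by_contra! hle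
    have hx : q.1 < x r₂ := by
      by_contra! hx
      exact h₂ ⟨by linarith, by linarith, by linarith, by linarith⟩
    exact h ⟨by linarith, by linarith, by linarith, by linarith⟩
  exact lt_asymm hlr hrl
end
end

section
/- Let Q be a finite set of points contained in the unit square R = [0,1]×[0,1], let W be a finite family of axis-parallel unit squares in general position, each containing exactly one corner of R, and suppose some subfamily of W covers Q. Let S ⊆ W be a cover of Q with ply(S) = ply*(Q,W) such that every square of S is necessary (for every B ∈ S, the family S∖{B} does not cover Q). Then there exists T ⊆ S with |T| ≤ 4 such that for every pair of adjacent corners of R (i.e., the pairs (c₁,c₂), (c₂,c₃), (c₃,c₄), (c₄,c₁)), no square of S∖T containing the first corner of the pair intersects any square of S∖T containing the second corner of the pair. -/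
open Set

noncomputable section

/-- If every square of a cover is necessary, then no square of the cover is contained, within a
region `R` containing the covered points, in the union of two other squares of the cover. -/
lemma eq_or_eq_of_inter_subset_union {S : Finset (Set (ℝ × ℝ))} {Q R : Set (ℝ × ℝ)}
    (hQ : Q ⊆ R) (hcov : Covers S Q) (hnec : ∀ B ∈ S, ¬ Covers (S.erase B) Q)
    {A B C : Set (ℝ × ℝ)} (hA : A ∈ S) (hB : B ∈ S) (hC : C ∈ S) (h : C ∩ R ⊆ A ∪ B) :
    C = A ∨ C = B := by
  by_contra! hne
  refine hnec C hC fun q hq => ?_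
  obtain ⟨D, hD, hqD⟩ := mem_iUnion₂.1 (hcov hq)
  by_cases hDC : D = C
  · subst hDC
    rcases h ⟨hqD, hQ hq⟩ with hq' | hq'
    · exact mem_iUnion₂.2 ⟨A, Finset.mem_erase.2 ⟨hne.1.symm, hA⟩, hq'⟩
    · exact mem_iUnion₂.2 ⟨B, Finset.mem_erase.2 ⟨hne.2.symm, hB⟩, hq'⟩
  · exact mem_iUnion₂.2 ⟨D, Finset.mem_erase.2 ⟨hDC, hD⟩, hqD⟩

/-- For a minimum ply cover `S` with all squares necessary, where each square of
`W` contains exactly one corner of `R = [0,1]²`, one can remove at most four squares so that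
for every pair of adjacent corners of `R`, no remaining square containing the first corner
intersects a remaining square containing the second corner. -/
theorem min_ply_cover_adjacent_corners_almost_separated
    (Q : Finset (ℝ × ℝ)) (W : Finset (Set (ℝ × ℝ)))
    (hQ : (↑Q : Set (ℝ × ℝ)) ⊆ unitSq 0 0)
    (hW : ∀ s ∈ W, IsUnitSquare s)
    (hGP : GeneralPosition W)
    (hcorner : ∀ s ∈ W, ∃! c : ℝ × ℝ,
      c ∈ ({((0 : ℝ), (1 : ℝ)), (1, 1), (1, 0), (0, 0)} : Set (ℝ × ℝ)) ∧ c ∈ s)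
    (hcov : ∃ S : Finset (Set (ℝ × ℝ)), S ⊆ W ∧ Covers S ↑Q)
    (S : Finset (Set (ℝ × ℝ))) (hSW : S ⊆ W) (hScov : Covers S ↑Q)
    (hply : ply S = plyStar ↑Q W)
    (hnec : ∀ B ∈ S, ¬ Covers (S.erase B) ↑Q) :
    ∃ T ⊆ S, T.card ≤ 4 ∧
      ∀ pq ∈ ([(((0 : ℝ), (1 : ℝ)), ((1 : ℝ), (1 : ℝ))),
               (((1 : ℝ), (1 : ℝ)), ((1 : ℝ), (0 : ℝ))),
               (((1 : ℝ), (0 : ℝ)), ((0 : ℝ), (0 : ℝ))),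
               (((0 : ℝ), (0 : ℝ)), ((0 : ℝ), (1 : ℝ)))] :
                 List ((ℝ × ℝ) × (ℝ × ℝ))),
        ∀ s ∈ S \ T, ∀ t ∈ S \ T, pq.1 ∈ s → pq.2 ∈ t → s ∩ t = ∅ := by
  rcases S.eq_empty_or_nonempty with rfl | hne
  · exact ⟨∅, by simp⟩
  choose! a b hab using fun s (hs : s ∈ S) => hW s (hSW hs)
  obtain ⟨M₁, hM₁, h₁⟩ := S.exists_max_image b hne
  obtain ⟨M₂, hM₂, h₂⟩ := S.exists_max_image a hne
  obtain ⟨M₃, hM₃, h₃⟩ := S.exists_min_image b hne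
  obtain ⟨M₄, hM₄, h₄⟩ := S.exists_min_image a hne
  refine ⟨{M₁, M₂, M₃, M₄}, ?_, Finset.card_le_four, ?_⟩
  · simp [Finset.insert_subset_iff, hM₁, hM₂, hM₃, hM₄]
  have mem_iff : ∀ s ∈ S, ∀ p : ℝ × ℝ,
      p ∈ s ↔ (a s ≤ p.1 ∧ p.1 ≤ a s + 1) ∧ b s ≤ p.2 ∧ p.2 ≤ b s + 1 := by
    intro s hs p
    conv_lhs => rw [hab s hs]
    simp only [unitSq, mem_prod, mem_Icc]
  have key : ∀ s ∈ S, ∀ t ∈ S, ∀ M ∈ S, M ≠ s → M ≠ t →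
      ∃ q : ℝ × ℝ, (0 ≤ q.1 ∧ q.1 ≤ 1) ∧ (0 ≤ q.2 ∧ q.2 ≤ 1) ∧
        q ∈ M ∧ q ∉ s ∧ q ∉ t := by
    intro s hs t ht M hM hMs hMt
    by_contra! h
    refine (eq_or_eq_of_inter_subset_union hQ hScov hnec hs ht hM fun q hq => ?_).elim hMs hMt
    obtain ⟨hqM, hqR⟩ := hq
    simp only [unitSq, mem_prod, mem_Icc, zero_add] at hqR
    exact or_iff_not_imp_left.2 (h q hqR.1 hqR.2 hqM)
  intro pq hpq s hs t ht hps hpt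
  simp only [Finset.mem_sdiff, Finset.mem_insert, Finset.mem_singleton, not_or] at hs ht
  obtain ⟨hsS, hs₁, hs₂, hs₃, hs₄⟩ := hs
  obtain ⟨htS, ht₁, ht₂, ht₃, ht₄⟩ := ht
  by_contra hst
  obtain ⟨r, hrs, hrt⟩ := nonempty_iff_ne_empty.2 hst
  rw [mem_iff s hsS] at hps hrs
  rw [mem_iff t htS] at hpt hrt
  simp only [List.mem_cons, List.not_mem_nil, or_false] at hpq
  rcases hpq with rfl | rfl | rfl | rfl
  · obtain ⟨q, hq1, hq2, hqM, hqs, hqt⟩ :=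
      key s hsS t htS M₁ hM₁ (Ne.symm hs₁) (Ne.symm ht₁)
    have := h₁ s hsS
    have := h₁ t htS
    grind
  · obtain ⟨q, hq1, hq2, hqM, hqs, hqt⟩ :=
      key s hsS t htS M₂ hM₂ (Ne.symm hs₂) (Ne.symm ht₂)
    have := h₂ s hsS
    have := h₂ t htS
    grind
  · obtain ⟨q, hq1, hq2, hqM, hqs, hqt⟩ :=
      key s hsS t htS M₃ hM₃ (Ne.symm hs₃) (Ne.symm ht₃)
    have := h₃ s hsS
    have := h₃ t htS
    grind
  · obtain ⟨q, hq1, hq2, hqM, hqs, hqt⟩ :=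
      key s hsS t htS M₄ hM₄ (Ne.symm hs₄) (Ne.symm ht₄)
    have := h₄ s hsS
    have := h₄ t htS
    grind
end
end

section
/- Let A, B, C, D be axis-parallel unit squares in ℝ² such that (0,1) ∈ A, (1,1) ∈ B, (1,0) ∈ C, and (0,0) ∈ D. If A ∩ B = ∅ and C ∩ D = ∅, then it is not possible that both A ∩ C ≠ ∅ and B ∩ D ≠ ∅. In other words, given that each pair of squares at adjacent top corners and at adjacent bottom corners is disjoint, at most one of the two diagonal pairs (A,C) and (B,D) can intersect. -/
open Set

noncomputable section

theorem unitSq_inter_nonempty_iff {a b c d : ℝ} :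
    (unitSq a b ∩ unitSq c d).Nonempty ↔ |a - c| ≤ 1 ∧ |b - d| ≤ 1 := by
  simp only [unitSq, Set.prod_inter_prod, Set.prod_nonempty_iff, Set.Icc_inter_Icc,
    Set.nonempty_Icc, sup_le_iff, le_inf_iff, abs_le]
  constructor
  · rintro ⟨⟨⟨_, _⟩, _, _⟩, ⟨_, _⟩, _, _⟩
    refine ⟨⟨?_, ?_⟩, ?_, ?_⟩ <;> linarith
  · rintro ⟨⟨_, _⟩, _, _⟩
    refine ⟨⟨⟨?_, ?_⟩, ?_, ?_⟩, ⟨?_, ?_⟩, ?_, ?_⟩ <;> linarith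

/-- If the squares at the two top corners are disjoint and the squares at the two
bottom corners are disjoint, then the two diagonal pairs cannot both intersect. -/
theorem not_both_diagonal_pairs_intersect
    (A B C D : Set (ℝ × ℝ))
    (hA : IsUnitSquare A) (hB : IsUnitSquare B) (hC : IsUnitSquare C) (hD : IsUnitSquare D)
    (hAc : ((0 : ℝ), (1 : ℝ)) ∈ A) (hBc : ((1 : ℝ), (1 : ℝ)) ∈ B)
    (hCc : ((1 : ℝ), (0 : ℝ)) ∈ C) (hDc : ((0 : ℝ), (0 : ℝ)) ∈ D)
    (hAB : A ∩ B = ∅) (hCD : C ∩ D = ∅) :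
    ¬ ((A ∩ C).Nonempty ∧ (B ∩ D).Nonempty) := by
  obtain ⟨a, a', rfl⟩ := hA
  obtain ⟨b, b', rfl⟩ := hB
  obtain ⟨c, c', rfl⟩ := hC
  obtain ⟨d, d', rfl⟩ := hD
  rw [← Set.not_nonempty_iff_eq_empty, unitSq_inter_nonempty_iff] at hAB hCD
  rw [unitSq_inter_nonempty_iff, unitSq_inter_nonempty_iff]
  rintro ⟨⟨hAC, -⟩, hBD, -⟩
  simp only [unitSq, Set.mem_prod, Set.mem_Icc] at hAc hBc hCc hDc
  obtain ⟨⟨_, _⟩, _, _⟩ := hAc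
  obtain ⟨⟨_, _⟩, _, _⟩ := hBc
  obtain ⟨⟨_, _⟩, _, _⟩ := hCc
  obtain ⟨⟨_, _⟩, _, _⟩ := hDc
  rw [abs_le] at hAC hBD
  have hab : a + 1 < b := by
    by_contra! h
    exact hAB ⟨abs_le.2 ⟨by linarith, by linarith⟩, abs_le.2 ⟨by linarith, by linarith⟩⟩
  have hdc : d + 1 < c := by
    by_contra! h
    exact hCD ⟨abs_le.2 ⟨by linarith, by linarith⟩, abs_le.2 ⟨by linarith, by linarith⟩⟩
  linarith [hAC.1, hBD.2]
end
end

section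
/- Let Q be a finite nonempty set of points contained in the unit square R = [0,1]×[0,1], and let W be a finite family of axis-parallel unit squares each containing the corner (1,1) of R. Let z ∈ Q be a point with minimum x-coordinate among the points of Q, and let B ∈ W be a square containing z whose bottom side has minimum y-coordinate among all squares of W containing z. Then for every square A ∈ W with z ∈ A, every point of Q that lies in A also lies in B, i.e., Q ∩ A ⊆ B. -/
open Set

noncomputable section

/-- greedy exchange property.  If `z` is a leftmost point of `Q` and
`B = [bB₁,bB₁+1] × [bB₂,bB₂+1]` is a square of `W` containing `z` with lowest bottom side
among squares of `W` containing `z`, then for every `A ∈ W` containing `z`,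
`Q ∩ A ⊆ B`. -/
theorem greedy_square_covers_all_covered_points
    (Q : Finset (ℝ × ℝ)) (hQne : Q.Nonempty)
    (hQ : (↑Q : Set (ℝ × ℝ)) ⊆ unitSq 0 0)
    (W : Finset (Set (ℝ × ℝ))) (hW : ∀ s ∈ W, IsUnitSquare s)
    (hWc : ∀ s ∈ W, ((1 : ℝ), (1 : ℝ)) ∈ s)
    (z : ℝ × ℝ) (hz : z ∈ Q) (hzmin : ∀ q ∈ Q, z.1 ≤ q.1)
    (bB₁ bB₂ : ℝ) (hBW : unitSq bB₁ bB₂ ∈ W) (hzB : z ∈ unitSq bB₁ bB₂)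
    (hBmin : ∀ a b : ℝ, unitSq a b ∈ W → z ∈ unitSq a b → bB₂ ≤ b) :
    ∀ A ∈ W, z ∈ A → (↑Q : Set (ℝ × ℝ)) ∩ A ⊆ unitSq bB₁ bB₂ := by
  rintro A hA hzA q ⟨hqQ, hqA⟩
  obtain ⟨a, b, rfl⟩ := hW A hA
  have hb : bB₂ ≤ b := hBmin a b hA hzA
  have hzq : z.1 ≤ q.1 := hzmin q hqQ
  have hqR := hQ hqQ
  have hcB := hWc _ hBW
  simp only [unitSq, Set.mem_prod, Set.mem_Icc] at *
  refine ⟨⟨?_, ?_⟩, ?_, ?_⟩ <;> linarith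
end
end

section
/- Let Q be a finite nonempty set of points contained in the unit square R = [0,1]×[0,1], and let W be a finite family of axis-parallel unit squares, each containing the corner (1,1) of R, such that some subfamily of W covers Q. Let z ∈ Q be a point with minimum x-coordinate among the points of Q, and let B ∈ W be a square containing z whose bottom side has minimum y-coordinate among all squares of W containing z. Then the minimum cardinality of a subfamily of W covering Q equals 1 plus the minimum cardinality of a subfamily of W covering Q ∖ B (where the minimum cardinality of a cover of the empty set is 0). -/
open Set

noncomputable section

/-- greedy step for minimum-cardinality covering.  With `z` a leftmost point of
`Q` and `B = [bB₁,bB₁+1] × [bB₂,bB₂+1]` a square of `W` containing `z` with lowest bottom side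
among squares of `W` containing `z`, the minimum cardinality of a cover of `Q` is one more
than the minimum cardinality of a cover of `Q ∖ B`. -/
theorem greedy_min_card_cover_step
    (Q : Finset (ℝ × ℝ)) (hQne : Q.Nonempty)
    (hQ : (↑Q : Set (ℝ × ℝ)) ⊆ unitSq 0 0)
    (W : Finset (Set (ℝ × ℝ))) (hW : ∀ s ∈ W, IsUnitSquare s)
    (hWc : ∀ s ∈ W, ((1 : ℝ), (1 : ℝ)) ∈ s)
    (hcov : ∃ S : Finset (Set (ℝ × ℝ)), S ⊆ W ∧ Covers S ↑Q)
    (z : ℝ × ℝ) (hz : z ∈ Q) (hzmin : ∀ q ∈ Q, z.1 ≤ q.1)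
    (bB₁ bB₂ : ℝ) (hBW : unitSq bB₁ bB₂ ∈ W) (hzB : z ∈ unitSq bB₁ bB₂)
    (hBmin : ∀ a b : ℝ, unitSq a b ∈ W → z ∈ unitSq a b → bB₂ ≤ b) :
    sInf {n : ℕ | ∃ S : Finset (Set (ℝ × ℝ)), S ⊆ W ∧ Covers S ↑Q ∧ S.card = n}
      = 1 + sInf {n : ℕ | ∃ S : Finset (Set (ℝ × ℝ)), S ⊆ W ∧
          Covers S ((↑Q : Set (ℝ × ℝ)) \ unitSq bB₁ bB₂) ∧ S.card = n} := by
  have hsub : ∀ s ∈ W, z ∈ s → ∀ q ∈ Q, q ∈ s → q ∈ unitSq bB₁ bB₂ := by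
    intro s hs hzs q hq hqs
    obtain ⟨a, b, rfl⟩ := hW s hs
    have hb := hBmin a b hs hzs
    have hq0 := hQ hq
    have hB1 := hWc _ hBW
    have hzq := hzmin q hq
    simp only [unitSq, Set.mem_prod, Set.mem_Icc] at *
    refine ⟨⟨?_, ?_⟩, ?_, ?_⟩ <;> linarith
  have hcov' : ∃ S : Finset (Set (ℝ × ℝ)), S ⊆ W ∧
      Covers S ((↑Q : Set (ℝ × ℝ)) \ unitSq bB₁ bB₂) := by
    obtain ⟨S, hSW, hS⟩ := hcov
    exact ⟨S, hSW, Set.sdiff_subset.trans hS⟩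
  apply le_antisymm
  · obtain ⟨S₀, hS₀W, hS₀⟩ := hcov'
    obtain ⟨S, hSW, hS, hcard⟩ := Nat.sInf_mem (s := {n : ℕ | ∃ S : Finset (Set (ℝ × ℝ)), S ⊆ W ∧
          Covers S ((↑Q : Set (ℝ × ℝ)) \ unitSq bB₁ bB₂) ∧ S.card = n})
      ⟨_, S₀, hS₀W, hS₀, rfl⟩
    rw [← hcard, add_comm]
    refine le_trans (Nat.sInf_le ?_) (Finset.card_insert_le (unitSq bB₁ bB₂) S)
    refine ⟨insert (unitSq bB₁ bB₂) S, Finset.insert_subset hBW hSW, ?_, rfl⟩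
    intro q hq
    by_cases hqB : q ∈ unitSq bB₁ bB₂
    · exact Set.mem_biUnion (Finset.mem_insert_self _ _) hqB
    · obtain ⟨s, hs, hqs⟩ := Set.mem_iUnion₂.mp (hS ⟨hq, hqB⟩)
      exact Set.mem_biUnion (Finset.mem_insert_of_mem hs) hqs
  · obtain ⟨S₀, hS₀W, hS₀⟩ := hcov
    obtain ⟨S, hSW, hS, hcard⟩ := Nat.sInf_mem (s := {n : ℕ | ∃ S : Finset (Set (ℝ × ℝ)), S ⊆ W ∧
          Covers S ↑Q ∧ S.card = n}) ⟨_, S₀, hS₀W, hS₀, rfl⟩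
    obtain ⟨s, hs, hzs⟩ := Set.mem_iUnion₂.mp (hS hz)
    rw [← hcard, ← Finset.card_erase_add_one hs, add_comm 1]
    refine Nat.add_le_add_right (Nat.sInf_le ?_) 1
    refine ⟨S.erase s, (Finset.erase_subset _ _).trans hSW, ?_, rfl⟩
    rintro q ⟨hq, hqB⟩
    obtain ⟨t, ht, hqt⟩ := Set.mem_iUnion₂.mp (hS hq)
    refine Set.mem_biUnion (Finset.mem_erase.mpr ⟨?_, ht⟩) hqt
    rintro rfl
    exact hqB (hsub t (hSW ht) hzs q hq hqt)
end
end

section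
/- Let p be any point of the unit grid cell C = [0,1]×[0,1], and let S₁, S₂, S₃, S₄ be axis-parallel unit squares, each containing p, such that S₁ intersects the diagonal neighbour cell [1,2]×[1,2], S₂ intersects [−1,0]×[1,2], S₃ intersects [−1,0]×[−1,0], and S₄ intersects [1,2]×[−1,0]. Then C ⊆ S₁ ∪ S₂ ∪ S₃ ∪ S₄. -/
open Set

noncomputable section

/-- If a point `p` of the cell `C = [0,1]²` is covered by four unit squares, each
intersecting one of the four diagonal neighbour cells, then these four squares cover `C`. -/
theorem four_diagonal_squares_cover_cell
    (p : ℝ × ℝ) (hp : p ∈ unitSq 0 0)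
    (S₁ S₂ S₃ S₄ : Set (ℝ × ℝ))
    (h₁ : IsUnitSquare S₁) (h₂ : IsUnitSquare S₂)
    (h₃ : IsUnitSquare S₃) (h₄ : IsUnitSquare S₄)
    (hp₁ : p ∈ S₁) (hp₂ : p ∈ S₂) (hp₃ : p ∈ S₃) (hp₄ : p ∈ S₄)
    (hi₁ : (S₁ ∩ unitSq 1 1).Nonempty)
    (hi₂ : (S₂ ∩ unitSq (-1) 1).Nonempty)
    (hi₃ : (S₃ ∩ unitSq (-1) (-1)).Nonempty)
    (hi₄ : (S₄ ∩ unitSq 1 (-1)).Nonempty) :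
    unitSq 0 0 ⊆ S₁ ∪ S₂ ∪ S₃ ∪ S₄ := by
  obtain ⟨a₁, b₁, rfl⟩ := h₁
  obtain ⟨a₂, b₂, rfl⟩ := h₂
  obtain ⟨a₃, b₃, rfl⟩ := h₃
  obtain ⟨a₄, b₄, rfl⟩ := h₄
  obtain ⟨q₁, hi₁⟩ := hi₁
  obtain ⟨q₂, hi₂⟩ := hi₂
  obtain ⟨q₃, hi₃⟩ := hi₃
  obtain ⟨q₄, hi₄⟩ := hi₄
  intro q hq
  simp only [unitSq, mem_inter_iff, mem_union, mem_prod, mem_Icc] at *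
  -- Each square contains the rectangle spanned by `p` and its own corner of the cell.
  rcases le_total p.1 q.1 with hx | hx <;> rcases le_total p.2 q.2 with hy | hy
  · exact Or.inl (Or.inl (Or.inl (by refine ⟨⟨?_, ?_⟩, ?_, ?_⟩ <;> linarith)))
  · exact Or.inr (by refine ⟨⟨?_, ?_⟩, ?_, ?_⟩ <;> linarith)
  · exact Or.inl (Or.inl (Or.inr (by refine ⟨⟨?_, ?_⟩, ?_, ?_⟩ <;> linarith)))
  · exact Or.inl (Or.inr (by refine ⟨⟨?_, ?_⟩, ?_, ?_⟩ <;> linarith))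
end
end

section
/- Let A = [a₁,a₁+1]×[a₂,a₂+1] and B = [b₁,b₁+1]×[b₂,b₂+1] be axis-parallel unit squares both containing the point (0,1), and let C be an axis-parallel unit square containing the point (1,1). Suppose the right side of A crosses the bottom side of B, i.e., b₁ ≤ a₁+1 ≤ b₁+1 and a₂ ≤ b₂ ≤ a₂+1, and suppose the crossing point r = (a₁+1, b₂) belongs to C. Then every point of B lying in the unit square R = [0,1]×[0,1] belongs to A or to C, i.e., B ∩ R ⊆ A ∪ C. -/
open Set

noncomputable section

/-- If the right side of `A` crosses the bottom side of `B` (both containing the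
top-left corner of `R`) and the crossing point `r = (a₁+1, b₂)` lies in a square `C` containing
the top-right corner, then `B ∩ R ⊆ A ∪ C`. -/
theorem crossing_point_covered_makes_B_unnecessary
    (a₁ a₂ b₁ b₂ : ℝ) (C : Set (ℝ × ℝ)) (hC : IsUnitSquare C)
    (hA : ((0 : ℝ), (1 : ℝ)) ∈ unitSq a₁ a₂)
    (hB : ((0 : ℝ), (1 : ℝ)) ∈ unitSq b₁ b₂)
    (hCc : ((1 : ℝ), (1 : ℝ)) ∈ C)
    (hcross₁ : b₁ ≤ a₁ + 1 ∧ a₁ + 1 ≤ b₁ + 1)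
    (hcross₂ : a₂ ≤ b₂ ∧ b₂ ≤ a₂ + 1)
    (hr : ((a₁ + 1, b₂) : ℝ × ℝ) ∈ C) :
    unitSq b₁ b₂ ∩ unitSq 0 0 ⊆ unitSq a₁ a₂ ∪ C := by
  obtain ⟨c₁, c₂, rfl⟩ := hC
  rintro ⟨x, y⟩ ⟨hxy, hR⟩
  simp only [unitSq, mem_union, mem_prod, mem_Icc] at *
  rcases le_total x (a₁ + 1) with hx | hx
  · left
    refine ⟨⟨?_, ?_⟩, ?_, ?_⟩ <;> linarith
  · right
    refine ⟨⟨?_, ?_⟩, ?_, ?_⟩ <;> linarith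
end
end

section
/- Let C = [c₁,c₁+1]×[c₂,c₂+1] and D = [d₁,d₁+1]×[d₂,d₂+1] be axis-parallel unit squares both containing the point (1,1), with c₁ ≤ d₁ and d₂ ≤ c₂, and let B be an axis-parallel unit square containing the point (0,1) that contains the point (d₁, c₂) (the lower-left corner of C ∩ D ∩ [0,1]²). Then every point of C lying in the unit square R = [0,1]×[0,1] belongs to B or to D, i.e., C ∩ R ⊆ B ∪ D. -/
open Set

noncomputable section

/-- If `C` and `D` both contain the top-right corner of `R` with `c₁ ≤ d₁` and
`d₂ ≤ c₂`, and a square `B` containing the top-left corner contains the point `(d₁, c₂)`,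
then `C ∩ R ⊆ B ∪ D`. -/
theorem intersection_point_covered_makes_C_unnecessary
    (c₁ c₂ d₁ d₂ : ℝ) (B : Set (ℝ × ℝ)) (hB : IsUnitSquare B)
    (hC : ((1 : ℝ), (1 : ℝ)) ∈ unitSq c₁ c₂)
    (hD : ((1 : ℝ), (1 : ℝ)) ∈ unitSq d₁ d₂)
    (hcd : c₁ ≤ d₁) (hdc : d₂ ≤ c₂)
    (hBc : ((0 : ℝ), (1 : ℝ)) ∈ B)
    (hBr : ((d₁, c₂) : ℝ × ℝ) ∈ B) :
    unitSq c₁ c₂ ∩ unitSq 0 0 ⊆ B ∪ unitSq d₁ d₂ := by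
  obtain ⟨a, b, rfl⟩ := hB
  simp only [unitSq, mem_prod, mem_Icc] at hC hD hBc hBr
  rintro ⟨x, y⟩ ⟨hxyC, hxyR⟩
  simp only [unitSq, mem_union, mem_prod, mem_Icc] at hxyC hxyR ⊢
  obtain hx | hx := le_total d₁ x
  · right
    refine ⟨⟨?_, ?_⟩, ?_, ?_⟩ <;> linarith
  · left
    refine ⟨⟨?_, ?_⟩, ?_, ?_⟩ <;> linarith
end
end
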